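/- Let K(x,y) = 1/(1 + (x−y)²) be the inverse quadratic kernel on ℝ, let Ω ⊆ ℝ be a set having an accumulation point, and let p : ℝ → ℝ be a polynomial that is not identically zero. Then p|_Ω ∉ H_K(Ω); concretely, there exists no function g : ℝ → ℝ such that (x,y) ↦ K(x,y) − c² g(x) g(y) is positive semidefinite on ℝ for some c > 0 and g(x) = p(x) for all x ∈ Ω. -/

import Mathlib

/-- `K` is a positive-semidefinite kernel. -/
def IsPSDKernel {Ω : Type*} (K : Ω → Ω → ℝ) : Prop :=
  ∀ (N : ℕ) (a : Fin N → ℝ) (x : Fin N → Ω),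
    0 ≤ ∑ n : Fin N, ∑ m : Fin N, a n * a m * K (x n) (x m)

open Filter Topology ComplexConjugate

section Factorisation

variable {V E : Type*} [AddCommGroup V] [Module ℝ V] [NormedAddCommGroup E] [NormedSpace ℝ E]

/-- A linear functional dominated by the norm of a linear map factors through that map by a
continuous linear functional. -/
theorem exists_continuousLinearMap_comp_eq (T : V →ₗ[ℝ] E) (L : V →ₗ[ℝ] ℝ) (C : ℝ)
    (h : ∀ v, ‖L v‖ ≤ C * ‖T v‖) : ∃ l : E →L[ℝ] ℝ, ∀ v, l (T v) = L v := by
  have hker : LinearMap.ker T ≤ LinearMap.ker L := fun v hv => by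
    have hT : T v = 0 := hv
    simpa [hT] using h v
  let f₀ : LinearMap.range T →ₗ[ℝ] ℝ :=
    (LinearMap.ker T).liftQ L hker ∘ₗ T.quotKerEquivRange.symm.toLinearMap
  have hf₀ (v : V) : f₀ ⟨T v, v, rfl⟩ = L v := by
    have : T.quotKerEquivRange.symm ⟨T v, v, rfl⟩ = (LinearMap.ker T).mkQ v := by
      rw [LinearEquiv.symm_apply_eq]
      rfl
    simp [f₀, this]
  have hbound : ∀ w, ‖f₀ w‖ ≤ C * ‖w‖ := by
    rintro ⟨_, v, rfl⟩
    rw [hf₀]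
    exact h v
  obtain ⟨l, hl, -⟩ := exists_extension_norm_eq _ (f₀.mkContinuous C hbound)
  exact ⟨l, fun v => (hl ⟨T v, v, rfl⟩).trans (hf₀ v)⟩

end Factorisation

theorem IsPSDKernel.finsupp_sum_nonneg {Ω : Type*} {K : Ω → Ω → ℝ} (hK : IsPSDKernel K)
    (v : Ω →₀ ℝ) : 0 ≤ ∑ x ∈ v.support, ∑ y ∈ v.support, v x * v y * K x y := by
  have e := v.support.equivFin
  have := hK _ (fun i => v (e.symm i)) (fun i => (e.symm i : Ω))
  rw [← Finset.sum_coe_sort]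
  simp_rw [← Finset.sum_coe_sort v.support (fun y => v _ * v y * K _ y)]
  rw [← Equiv.sum_comp e.symm]
  simpa only [← Equiv.sum_comp e.symm] using this

/-- If `K` is represented by a feature map `F`, every `g` with `K - c² g ⊗ g` positive
semidefinite is a continuous linear functional of the features. -/
theorem IsPSDKernel.exists_eq_inner {Ω H : Type*} [NormedAddCommGroup H] [InnerProductSpace ℝ H]
    [CompleteSpace H] (F : Ω → H) (g : Ω → ℝ) {c : ℝ} (hc : 0 < c)
    (hg : IsPSDKernel fun u v => inner ℝ (F u) (F v) - c ^ 2 * g u * g v) :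
    ∃ h : H, ∀ x, g x = inner ℝ h (F x) := by
  obtain ⟨l, hl⟩ := exists_continuousLinearMap_comp_eq (Finsupp.linearCombination ℝ F)
    (Finsupp.linearCombination ℝ g) c⁻¹ fun v => by
      have key := hg.finsupp_sum_nonneg v
      have h1 : ‖Finsupp.linearCombination ℝ F v‖ ^ 2 =
          ∑ x ∈ v.support, ∑ y ∈ v.support, v x * v y * inner ℝ (F x) (F y) := by
        rw [← real_inner_self_eq_norm_sq, Finsupp.linearCombination_apply, Finsupp.sum, sum_inner]
        refine Finset.sum_congr rfl fun x _ => ?_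
        rw [inner_sum]
        refine Finset.sum_congr rfl fun y _ => ?_
        rw [real_inner_smul_left, real_inner_smul_right]
        ring
      have h2 : (c * Finsupp.linearCombination ℝ g v) ^ 2 =
          ∑ x ∈ v.support, ∑ y ∈ v.support, v x * v y * (c ^ 2 * g x * g y) := by
        rw [mul_pow, Finsupp.linearCombination_apply, Finsupp.sum, sq (∑ x ∈ _, _),
          Finset.sum_mul_sum, Finset.mul_sum]
        refine Finset.sum_congr rfl fun x _ => ?_
        rw [Finset.mul_sum]
        refine Finset.sum_congr rfl fun y _ => ?_
        simp only [smul_eq_mul]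
        ring
      simp only [mul_sub, Finset.sum_sub_distrib] at key
      rw [← h1, ← h2] at key
      have h3 := abs_le_of_sq_le_sq (sub_nonneg.mp key) (norm_nonneg _)
      rw [Real.norm_eq_abs, inv_mul_eq_div, le_div_iff₀' hc]
      rwa [abs_mul, abs_of_pos hc] at h3
  refine ⟨(InnerProductSpace.toDual ℝ H).symm l, fun x => ?_⟩
  have := hl (Finsupp.single x 1)
  simp only [Finsupp.linearCombination_single, one_smul] at this
  rw [InnerProductSpace.toDual_symm_apply, this]

namespace InverseQuadratic

/-- The Cayley transform of the point `1/2 + i w` of the right half-plane. -/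
noncomputable def cayley (w : ℂ) : ℂ := Complex.I * w / (1 + Complex.I * w)

theorem one_add_I_mul_ofReal_ne_zero (x : ℝ) : 1 + Complex.I * x ≠ 0 := fun h => by
  simpa using congrArg Complex.re h

theorem norm_cayley_lt_one (x : ℝ) : ‖cayley x‖ < 1 := by
  rw [cayley, norm_div, div_lt_one (norm_pos_iff.mpr (one_add_I_mul_ofReal_ne_zero x))]
  refine lt_of_pow_lt_pow_left₀ 2 (norm_nonneg _) ?_
  rw [← Complex.normSq_eq_norm_sq, ← Complex.normSq_eq_norm_sq]
  simp [Complex.normSq_apply]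

theorem memℓp_feature (x : ℝ) :
    Memℓp (fun n : ℕ => cayley x ^ n / (1 + Complex.I * x)) 2 := by
  refine memℓp_gen ?_
  have h : ‖cayley x‖ ^ 2 < 1 := by
    have := norm_cayley_lt_one x
    have := norm_nonneg (cayley x)
    nlinarith
  refine ((summable_geometric_of_lt_one (by positivity) h).mul_right
    (‖1 + Complex.I * (x : ℂ)‖⁻¹ ^ 2)).congr fun n => ?_
  simp [div_eq_mul_inv, mul_pow, ← pow_mul, mul_comm]

/-- The feature map of the inverse quadratic kernel: Taylor coefficients of the Szegő kernel of
the half-plane transported to the disc. -/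
noncomputable def feature (x : ℝ) : lp (fun _ : ℕ => ℂ) 2 := ⟨_, memℓp_feature x⟩

theorem feature_apply (x : ℝ) (n : ℕ) : feature x n = cayley x ^ n / (1 + Complex.I * x) := rfl

theorem inner_feature (x y : ℝ) : inner ℝ (feature x) (feature y) = 1 / (1 + (x - y) ^ 2) := by
  have hlt : ‖conj (cayley x) * cayley y‖ < 1 := by
    rw [norm_mul, RCLike.norm_conj]
    have := norm_cayley_lt_one x
    have := norm_cayley_lt_one y
    have := norm_nonneg (cayley x)
    have := norm_nonneg (cayley y)
    nlinarith
  have hx := one_add_I_mul_ofReal_ne_zero x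
  have hy := one_add_I_mul_ofReal_ne_zero y
  have hx' : 1 - Complex.I * (x : ℂ) ≠ 0 := by
    simpa [sub_eq_add_neg] using one_add_I_mul_ofReal_ne_zero (-x)
  have hxy : 1 + Complex.I * ((y : ℂ) - x) ≠ 0 := by
    simpa using one_add_I_mul_ofReal_ne_zero (y - x)
  have hconj : conj (cayley x) = -(Complex.I * x) / (1 - Complex.I * x) := by
    simp [cayley, sub_eq_add_neg]
  have hs := (hasSum_geometric_of_norm_lt_one hlt).mul_left
    (1 / ((1 - Complex.I * (x : ℂ)) * (1 + Complex.I * y)))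
  have hval : 1 / ((1 - Complex.I * (x : ℂ)) * (1 + Complex.I * y)) *
      (1 - conj (cayley x) * cayley y)⁻¹ = (1 + Complex.I * ((y : ℂ) - x))⁻¹ := by
    have : 1 - conj (cayley x) * cayley y = (1 + Complex.I * ((y : ℂ) - x)) /
        ((1 - Complex.I * (x : ℂ)) * (1 + Complex.I * y)) := by
      rw [hconj, cayley]
      field_simp
      ring
    rw [this]
    field_simp
  rw [hval] at hs
  have hterm (n : ℕ) : inner ℝ (feature x n) (feature y n) =
      (1 / ((1 - Complex.I * (x : ℂ)) * (1 + Complex.I * y)) *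
        (conj (cayley x) * cayley y) ^ n).re := by
    rw [feature_apply, feature_apply, Complex.inner]
    congr 1
    simp only [map_div₀, map_pow, map_add, map_mul, map_one, Complex.conj_I, Complex.conj_ofReal]
    rw [mul_pow, neg_mul, ← sub_eq_add_neg]
    field_simp
  have hlim : (1 + Complex.I * ((y : ℂ) - x))⁻¹.re = 1 / (1 + (x - y) ^ 2) := by
    simp [Complex.inv_re, Complex.normSq_apply]
    ring
  rw [← hlim]
  exact (lp.hasSum_inner (feature x) (feature y)).unique
    (by simpa only [hterm] using Complex.hasSum_re hs)

theorem summable_mul_pow {a : ℕ → ℂ} {C : ℝ} (ha : ∀ n, ‖a n‖ ≤ C) {z : ℂ} (hz : ‖z‖ < 1) :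
    Summable fun n => a n * z ^ n := by
  refine Summable.of_norm_bounded (g := fun n => C * ‖z‖ ^ n)
    ((summable_geometric_of_lt_one (norm_nonneg _) hz).mul_left _) fun n => ?_
  rw [norm_mul, norm_pow]
  gcongr
  exact ha n

theorem analyticAt_tsum_mul_pow {a : ℕ → ℂ} {C : ℝ} (ha : ∀ n, ‖a n‖ ≤ C) {z : ℂ}
    (hz : ‖z‖ < 1) : AnalyticAt ℂ (fun w : ℂ => ∑' n, a n * w ^ n) z := by
  obtain ⟨r, hzr, hr⟩ := exists_between hz
  have hr0 : 0 ≤ r := (norm_nonneg z).trans hzr.le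
  have hC : 0 ≤ C := (norm_nonneg _).trans (ha 0)
  refine DifferentiableOn.analyticAt (s := Metric.ball 0 r) ?_
    (Metric.isOpen_ball.mem_nhds (by simpa using hzr))
  refine Complex.differentiableOn_tsum_of_summable_norm (u := fun n => C * r ^ n)
    ((summable_geometric_of_lt_one hr0 hr).mul_left _) (fun n => by fun_prop)
    Metric.isOpen_ball fun n w hw => ?_
  have hw' : ‖w‖ < r := by simpa using hw
  rw [norm_mul, norm_pow]
  gcongr
  exact ha n

theorem analyticAt_inner_feature (h : lp (fun _ : ℕ => ℂ) 2) (x : ℝ) :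
    AnalyticAt ℝ (fun x : ℝ => inner ℝ h (feature x)) x := by
  have hx := one_add_I_mul_ofReal_ne_zero x
  obtain ⟨a, ha⟩ : ∃ a : ℕ → ℂ, ∀ n, a n = h n := ⟨fun n => h n, fun _ => rfl⟩
  have hbound (n : ℕ) : ‖conj (a n)‖ ≤ ‖h‖ := by
    rw [RCLike.norm_conj, ha]
    exact lp.norm_apply_le_norm (by norm_num) h n
  have hc : AnalyticAt ℂ cayley x := by
    unfold cayley
    fun_prop (disch := exact hx)
  have hF : AnalyticAt ℂ
      (fun w : ℂ => (∑' n, conj (a n) * cayley w ^ n) / (1 + Complex.I * w)) x :=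
    (AnalyticAt.fun_comp (analyticAt_tsum_mul_pow hbound (norm_cayley_lt_one x)) hc).div
      (by fun_prop) hx
  refine hF.re_ofReal.congr (Eventually.of_forall fun y => ?_)
  have hre := Complex.hasSum_re ((summable_mul_pow hbound (norm_cayley_lt_one y)).hasSum.div_const
    (1 + Complex.I * (y : ℂ)))
  have hterm (n : ℕ) : inner ℝ (h n) (feature y n) =
      (conj (a n) * cayley y ^ n / (1 + Complex.I * (y : ℂ))).re := by
    rw [← ha, feature_apply, Complex.inner, mul_div_assoc, mul_comm]
  exact hre.unique (by simpa only [hterm] using lp.hasSum_inner (𝕜 := ℝ) h (feature y))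

/-- No nonzero constant function lies in the RKHS of the inverse quadratic kernel on `ℝ`. -/
theorem not_isPSDKernel_sub_const {e : ℝ} (he : 0 < e) :
    ¬ IsPSDKernel fun u v : ℝ => 1 / (1 + (u - v) ^ 2) - e := by
  intro h
  obtain ⟨N, hN⟩ := exists_nat_gt (1 / e)
  have hlim : Tendsto (fun R : ℝ => ∑ n : Fin N, ∑ m : Fin N,
      (1 : ℝ) * 1 * (1 / (1 + ((n : ℝ) * R - (m : ℝ) * R) ^ 2) - e)) atTop
      (𝓝 (∑ n : Fin N, ∑ m : Fin N, ((if n = m then 1 else 0) - e))) := by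
    refine tendsto_finsetSum _ fun n _ => tendsto_finsetSum _ fun m _ => ?_
    simp only [one_mul]
    refine Tendsto.sub_const ?_ e
    split_ifs with hnm
    · simp [hnm]
    · have hd : ((n : ℝ) - m) ≠ 0 := sub_ne_zero.mpr fun hh =>
        hnm (Fin.ext (by exact_mod_cast hh))
      simp only [← sub_mul, mul_pow, one_div]
      refine tendsto_inv_atTop_zero.comp (tendsto_atTop_add_const_left _ _ ?_)
      exact (tendsto_pow_atTop two_ne_zero).const_mul_atTop (by positivity)
  have hnn := ge_of_tendsto' hlim fun R => h N (fun _ => 1) fun n => (n : ℝ) * R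
  simp only [Finset.sum_sub_distrib, Finset.sum_ite_eq, Finset.mem_univ, if_true,
    Finset.sum_const, Finset.card_univ, Fintype.card_fin, nsmul_eq_mul, mul_one] at hnn
  rw [div_lt_iff₀ he] at hN
  have hN0 : (0 : ℝ) < N := by
    rcases Nat.eq_zero_or_pos N with rfl | h0
    · norm_num at hN
    · exact_mod_cast h0
  nlinarith

end InverseQuadratic

/-- For the inverse quadratic kernel `K(x,y) = 1/(1+(x-y)²)` on `ℝ`, a set
`Ω ⊆ ℝ` with an accumulation point and a nonzero polynomial `p`, the restriction `p|_Ω`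
is not in `H_K(Ω)`: there is no `g : ℝ → ℝ` such that `(x,y) ↦ K(x,y) - c² g(x) g(y)` is
positive semidefinite on `ℝ` for some `c > 0` and `g = p` on `Ω`. -/
theorem stmt11_inverse_quadratic_no_polynomials
    (K : ℝ → ℝ → ℝ) (hK : ∀ x y : ℝ, K x y = 1 / (1 + (x - y) ^ 2))
    (Ω : Set ℝ) (hΩ : ∃ q : ℝ, AccPt q (Filter.principal Ω))
    (p : Polynomial ℝ) (hp : p ≠ 0) :
    ¬ ∃ g : ℝ → ℝ, (∃ c : ℝ, 0 < c ∧
        IsPSDKernel (fun u v : ℝ => K u v - c ^ 2 * g u * g v)) ∧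
      ∀ x ∈ Ω, g x = p.eval x := by
  rintro ⟨g, ⟨c, hc, hpsd⟩, hgp⟩
  obtain rfl : K = fun x y => 1 / (1 + (x - y) ^ 2) := funext₂ hK
  obtain ⟨h, hgh⟩ := IsPSDKernel.exists_eq_inner InverseQuadratic.feature g hc
    (by simpa only [InverseQuadratic.inner_feature] using hpsd)
  have hga : AnalyticOnNhd ℝ g Set.univ := fun x _ => by
    rw [show g = _ from funext hgh]
    exact InverseQuadratic.analyticAt_inner_feature h x
  have hpa : AnalyticOnNhd ℝ (fun x => p.eval x) Set.univ := fun x _ =>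
    (AnalyticOnNhd.eval_polynomial p) x (Set.mem_univ x)
  obtain ⟨q, hq⟩ := hΩ
  obtain rfl : g = fun x => p.eval x := hga.eq_of_frequently_eq hpa
    ((accPt_iff_frequently_nhdsNE.mp hq).mono hgp)
  have hbdd (x : ℝ) : |p.eval x| ≤ c⁻¹ := by
    have := hpsd 1 (fun _ => 1) fun _ => x
    simp only [Finset.univ_unique, Finset.sum_singleton, sub_self] at this
    rw [← one_div, le_div_iff₀' hc]
    have habs : |c * p.eval x| ≤ 1 := abs_le_one_iff_mul_self_le_one.mpr (by linarith)
    rwa [abs_mul, abs_of_pos hc] at habs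
  have hdeg : p.degree ≤ 0 :=
    p.isBoundedUnder_abs_atTop_iff.mp ⟨c⁻¹, eventually_map.mpr (Eventually.of_forall hbdd)⟩
  obtain ⟨d, rfl⟩ : ∃ d, p = Polynomial.C d := ⟨_, Polynomial.eq_C_of_degree_le_zero hdeg⟩
  have hd : d ≠ 0 := by simpa using hp
  refine InverseQuadratic.not_isPSDKernel_sub_const (e := c ^ 2 * d * d) ?_ (by simpa using hpsd)
  rw [mul_assoc]
  exact mul_pos (by positivity) (mul_self_pos.mpr hd)
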